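/- arXiv:2407.21116 — 2 statements merged into one kernel-verified Lean document; each statement's English description precedes it below -/
import Mathlib

section
/- Let D be a reduced rectangular pipe dream of shape a×b. If D reduces to NW/SE partitions, then D is rigid. -/
/-- The simple transposition of the symmetric group on `Fin n` exchanging the
(0-based) positions `i` and `i+1`; it is the identity if `i+1 ≥ n`. -/
def simpleTransposition (n : ℕ) (i : ℕ) : Equiv.Perm (Fin n) :=
  if h : i + 1 < n then Equiv.swap ⟨i, Nat.lt_of_succ_lt h⟩ ⟨i + 1, h⟩ else 1

/-- The number of inversions (= Coxeter length) of a permutation of `Fin n`. -/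
def invCount {n : ℕ} (π : Equiv.Perm (Fin n)) : ℕ :=
  (Finset.univ.filter (fun p : Fin n × Fin n => p.1 < p.2 ∧ π p.2 < π p.1)).card

/-- A rectangular pipe dream of shape `a × b`: a set of crosses `D` inside the grid
`{1,…,a} × {1,…,b}` (first coordinate = row, from top to bottom; second = column,
from left to right).  Positions of the grid not in `D` are elbows. -/
def IsPipeDream (a b : ℕ) (D : Finset (ℕ × ℕ)) : Prop :=
  D ⊆ Finset.Icc 1 a ×ˢ Finset.Icc 1 b

/-- The reading word of a rectangular pipe dream of shape `a × b`: read the rows from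
bottom (`i = a`) to top (`i = 1`), each row from left (`j = 1`) to right (`j = b`);
a cross at `(i,j)` contributes the simple transposition `s_{i+j-1}` of `S_{a+b}`
(recorded here by its 0-based index `i + j - 2 = (i-1) + (j-1)`). -/
def readingWord (a b : ℕ) (D : Finset (ℕ × ℕ)) : List ℕ :=
  ((List.range a).reverse.flatMap fun r =>
    (List.range b).filterMap fun c =>
      if (r + 1, c + 1) ∈ D then some (r + c) else none)

/-- The permutation of a rectangular pipe dream: the product of its reading word. -/
def pdPerm (a b : ℕ) (D : Finset (ℕ × ℕ)) : Equiv.Perm (Fin (a + b)) :=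
  ((readingWord a b D).map (simpleTransposition (a + b))).prod

/-- A pipe dream is reduced if the Coxeter length of its permutation equals its number
of crosses. -/
def IsReducedPD (a b : ℕ) (D : Finset (ℕ × ℕ)) : Prop :=
  invCount (pdPerm a b D) = D.card

/-- A reduced rectangular pipe dream is rigid if it is the unique reduced rectangular
pipe dream of its shape with its permutation. -/
def IsRigid (a b : ℕ) (D : Finset (ℕ × ℕ)) : Prop :=
  ∀ D' : Finset (ℕ × ℕ), IsPipeDream a b D' → IsReducedPD a b D' →
    pdPerm a b D' = pdPerm a b D → D' = D

/-- A rectangular pipe dream of shape `a × b` reduces to NW/SE partitions if every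
cross lies in an entire row of crosses, an entire column of crosses, a partition of
crosses in the northwest corner, or a partition of crosses in the southeast corner. -/
def ReducesToNWSEPartitions (a b : ℕ) (D : Finset (ℕ × ℕ)) : Prop :=
  ∀ i j : ℕ, (i, j) ∈ D →
    (∀ jQ : ℕ, 1 ≤ jQ → jQ ≤ b → (i, jQ) ∈ D) ∨
    (∀ iQ : ℕ, 1 ≤ iQ → iQ ≤ a → (iQ, j) ∈ D) ∨
    (∀ iQ jQ : ℕ, 1 ≤ iQ → iQ ≤ i → 1 ≤ jQ → jQ ≤ j → (iQ, jQ) ∈ D) ∨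
    (∀ iQ jQ : ℕ, i ≤ iQ → iQ ≤ a → j ≤ jQ → jQ ≤ b → (iQ, jQ) ∈ D)


/-- action of one cell on wire positions -/
def cellF (D : Finset (ℕ × ℕ)) (r c x : ℕ) : ℕ :=
  if (r + 1, c + 1) ∈ D then (if x = r + c then r + c + 1 else if x = r + c + 1 then r + c else x)
  else x

/-- action of the first `m` cells of row `r` -/
def rowF (D : Finset (ℕ × ℕ)) (r : ℕ) : ℕ → ℕ → ℕ
  | 0, x => x
  | m + 1, x => cellF D r m (rowF D r m x)

/-- action of the rows `k-1, …, 0` -/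
def colF (D : Finset (ℕ × ℕ)) (b : ℕ) : ℕ → ℕ → ℕ
  | 0, x => x
  | k + 1, x => colF D b k (rowF D k b x)

section rows
variable (D : Finset (ℕ × ℕ)) (r : ℕ)

theorem cellF_cases (c x : ℕ) :
    ((r + 1, c + 1) ∈ D ∧ x = r + c ∧ cellF D r c x = r + c + 1) ∨
    ((r + 1, c + 1) ∈ D ∧ x = r + c + 1 ∧ cellF D r c x = r + c) ∨
    ((r + 1, c + 1) ∉ D ∧ cellF D r c x = x) ∨
    (x ≠ r + c ∧ x ≠ r + c + 1 ∧ cellF D r c x = x) := by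
  unfold cellF
  split_ifs <;> simp_all

theorem rowF_lt (m x : ℕ) (h : x < r) : rowF D r m x = x := by
  induction m with
  | zero => rfl
  | succ m ih =>
    have := cellF_cases D r m (rowF D r m x)
    simp only [rowF]; omega

theorem rowF_gt (m x : ℕ) (h : r + m < x) : rowF D r m x = x := by
  induction m with
  | zero => rfl
  | succ m ih =>
    have := cellF_cases D r m (rowF D r m x)
    have := ih (by omega)
    simp only [rowF]; omega

theorem rowF_le (m x : ℕ) (h : x ≤ r + m) : rowF D r m x ≤ r + m := by
  induction m with
  | zero => exact h
  | succ m ih =>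
    have := cellF_cases D r m (rowF D r m x)
    simp only [rowF]
    rcases Nat.lt_or_ge (r + m) x with h1 | h1
    · have := rowF_gt D r m x h1
      omega
    · have := ih h1
      omega

theorem rowF_drop (m x : ℕ) :
    x ≤ rowF D r m x ∨ (rowF D r m x + 1 = x ∧ x ≤ r + m) := by
  induction m with
  | zero => left; exact le_rfl
  | succ m ih =>
    have := cellF_cases D r m (rowF D r m x)
    simp only [rowF]; omega

theorem rowF_full (m : ℕ) (h : ∀ c < m, (r + 1, c + 1) ∈ D) : rowF D r m r = r + m := by
  induction m with
  | zero => rfl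
  | succ m ih =>
    have := cellF_cases D r m (rowF D r m r)
    have h1 := ih (fun c hc => h c (by omega))
    have h2 := h m (by omega)
    simp only [h2, not_true, true_and, false_and, false_or] at this
    simp only [rowF]; omega

theorem rowF_stay_ge (c m x : ℕ) (hcm : c ≤ m) (h : r + c ≤ rowF D r c x) :
    r + c ≤ rowF D r m x := by
  induction m, hcm using Nat.le_induction with
  | base => exact h
  | succ m hm ih =>
    have := cellF_cases D r m (rowF D r m x)
    simp only [rowF]; omega

theorem rowF_stay (c m x : ℕ) (hcm : c ≤ m) (h : rowF D r c x < r + c) :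
    rowF D r m x = rowF D r c x := by
  induction m, hcm using Nat.le_induction with
  | base => rfl
  | succ m hm ih =>
    have := cellF_cases D r m (rowF D r m x)
    simp only [rowF]; omega

theorem rowF_elbow_le (c m x : ℕ) (hcm : c < m) (hc : (r + 1, c + 1) ∉ D) (h : x ≤ r + c) :
    rowF D r m x ≤ r + c := by
  have h1 := rowF_le D r c x h
  have h2 : rowF D r (c + 1) x = rowF D r c x := by simp [rowF, cellF, hc]
  rw [rowF_stay D r (c + 1) m x hcm (by omega)]
  omega

theorem rowF_first (c m : ℕ) (hcm : c < m) (hc : (r + 1, c + 1) ∉ D)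
    (h : ∀ c' < c, (r + 1, c' + 1) ∈ D) : rowF D r m r = r + c := by
  have h1 := rowF_full D r c h
  have h2 : rowF D r (c + 1) r = rowF D r c r := by simp [rowF, cellF, hc]
  rw [rowF_stay D r (c + 1) m r hcm (by omega)]
  omega

theorem rowF_up (c m : ℕ) (hcm : c < m) (hc : (r + 1, c + 1) ∈ D) :
    rowF D r m (r + c + 1) = r + c := by
  have h1 := rowF_gt D r c (r + c + 1) (by omega)
  have h2 : rowF D r (c + 1) (r + c + 1) = r + c := by simp [rowF, cellF, hc, h1]
  rw [rowF_stay D r (c + 1) m _ hcm (by omega)]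
  omega

theorem rowF_elbow_ge (c m : ℕ) (hcm : c < m) (hc : (r + 1, c + 1) ∉ D) :
    r + c + 1 ≤ rowF D r m (r + c + 1) := by
  have h1 := rowF_gt D r c (r + c + 1) (by omega)
  have h2 : rowF D r (c + 1) (r + c + 1) = r + c + 1 := by simp [rowF, cellF, hc, h1]
  exact rowF_stay_ge D r (c + 1) m _ hcm (by omega)

theorem rowF_last (c m : ℕ) (hcm : c + 1 ≤ m) (hc : (r + 1, c + 1) ∉ D)
    (h : ∀ c', c < c' → c' < m → (r + 1, c' + 1) ∈ D) : rowF D r m (r + c + 1) = r + m := by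
  induction m, hcm using Nat.le_induction with
  | base =>
    have h1 := rowF_gt D r c (r + c + 1) (by omega)
    simp [rowF, cellF, hc, h1]; omega
  | succ m hm ih =>
    have := cellF_cases D r m (rowF D r m (r + c + 1))
    have h1 := ih (fun c' h1 h2 => h c' h1 (by omega))
    have h2 := h m (by omega) (by omega)
    simp only [h2, not_true, true_and, false_and, false_or] at this
    simp only [rowF]; omega

end rows

section cols
variable (D : Finset (ℕ × ℕ)) (b : ℕ)

theorem colF_ge (k x : ℕ) : x ≤ colF D b k x + k := by
  induction k generalizing x with
  | zero => exact le_rfl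
  | succ k ih =>
    have := ih (rowF D k b x)
    have := rowF_drop D k b x
    simp only [colF]; omega

theorem colF_lt (k x : ℕ) (h : x < k + b) : colF D b k x < k + b := by
  induction k generalizing x with
  | zero => exact h
  | succ k ih =>
    simp only [colF]
    have h1 := rowF_le D k b x (by omega)
    rcases Nat.lt_or_ge (rowF D k b x) (k + b) with h2 | h2
    · have := ih _ h2; omega
    · have : rowF D k b x = k + b := by omega
      rw [this]
      clear ih h h1 h2 this
      suffices ∀ j, j ≤ k → colF D b j (k + b) = k + b by have := this k le_rfl; omega
      intro j hj
      induction j with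
      | zero => rfl
      | succ j ih =>
        simp only [colF]
        rw [rowF_gt D j b (k + b) (by omega)]; exact ih (by omega)

theorem colF_fix (k x : ℕ) (h : k + b ≤ x) : colF D b k x = x := by
  induction k with
  | zero => rfl
  | succ k ih =>
    simp only [colF]
    rw [rowF_gt D k b x (by omega)]; exact ih (by omega)

theorem colF_left (r k : ℕ) (h : r < k) : colF D b k r = colF D b r (rowF D r b r) := by
  induction k, h using Nat.le_induction with
  | base => rfl
  | succ k hk ih =>
    simp only [colF]
    rw [rowF_lt D k b r (by omega)]; exact ih

theorem colF_up (k c : ℕ) (hc : c < b) (h : ∀ r < k, (r + 1, c + 1) ∈ D) :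
    colF D b k (k + c) = c := by
  induction k with
  | zero => simp [colF]
  | succ k ih =>
    simp only [colF]
    rw [show k + 1 + c = k + c + 1 by omega, rowF_up D k c b hc (h k (by omega))]
    exact ih (fun r hr => h r (by omega))

theorem colF_bot (r k c : ℕ) (hc : c < b) (hrk : r ≤ k)
    (h : ∀ r', r ≤ r' → r' < k → (r' + 1, c + 1) ∈ D) :
    colF D b k (k + c) = colF D b r (r + c) := by
  induction k, hrk using Nat.le_induction with
  | base => rfl
  | succ k hk ih =>
    simp only [colF]
    rw [show k + 1 + c = k + c + 1 by omega, rowF_up D k c b hc (h k (by omega) (by omega))]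
    exact ih (fun r' h1 h2 => h r' h1 (by omega))

/-- elbow in column `c` -/
theorem colF_elbow (r k c : ℕ) (hc : c < b) (hrk : r < k) (h : (r + 1, c + 1) ∉ D) (x : ℕ)
    (hx : k + c ≤ x) : c < colF D b k x := by
  induction k, hrk using Nat.le_induction generalizing x with
  | base =>
    simp only [colF]
    have h0 := colF_ge D b r (rowF D r b x)
    have h1 := rowF_elbow_ge D r c b hc h
    have h2 := rowF_drop D r b x
    rcases Nat.eq_or_lt_of_le hx with h3 | h3
    · rw [show r + c + 1 = x by omega] at h1
      omega
    · omega
  | succ k hk ih =>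
    simp only [colF]
    have h2 := rowF_drop D k b x
    exact ih _ (by omega)

end cols

section link
variable (D : Finset (ℕ × ℕ))

theorem simpleTransposition_val (n i : ℕ) (hi : i + 1 < n) (x : Fin n) :
    ((simpleTransposition n i)⁻¹ x).val =
      if x.val = i then i + 1 else if x.val = i + 1 then i else x.val := by
  unfold simpleTransposition
  rw [dif_pos hi, Equiv.swap_inv, Equiv.swap_apply_def]
  simp only [Fin.ext_iff]
  split_ifs <;> rfl

theorem row_link (n r m : ℕ) (h : r + m < n) (x : Fin n) :
    ((((((List.range m).filterMap fun c =>
      if (r + 1, c + 1) ∈ D then some (r + c) else none)).map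
        (simpleTransposition n)).prod)⁻¹ x).val = rowF D r m x.val := by
  induction m generalizing x with
  | zero => simp [rowF]
  | succ m ih =>
    rw [List.range_succ, List.filterMap_append, List.map_append, List.prod_append, mul_inv_rev,
      Equiv.Perm.mul_apply]
    simp only [rowF]
    rw [← ih (by omega) x]
    by_cases hD : (r + 1, m + 1) ∈ D
    · simp only [List.filterMap_cons, hD, if_true, List.filterMap_nil, List.map_cons, List.map_nil,
        List.prod_singleton, cellF]
      exact simpleTransposition_val n (r + m) (by omega) _
    · simp [hD, cellF]

theorem col_link (a b k : ℕ) (hk : k ≤ a) (x : Fin (a + b)) :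
    (((((readingWord k b D)).map (simpleTransposition (a + b))).prod)⁻¹ x).val
      = colF D b k x.val := by
  induction k generalizing x with
  | zero => simp [readingWord, colF]
  | succ k ih =>
    unfold readingWord
    rw [List.range_succ, List.reverse_append, List.reverse_singleton, List.singleton_append,
      List.flatMap_cons, List.map_append, List.prod_append, mul_inv_rev, Equiv.Perm.mul_apply]
    simp only [colF]
    rw [← row_link D (a + b) k b (by omega) x]
    exact ih (by omega) _

end link

/-- Every reduced rectangular pipe dream of shape `a × b` that reduces
to NW/SE partitions is rigid. -/
theorem rigid_of_reduces_to_NWSE (a b : ℕ) (D : Finset (ℕ × ℕ))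
    (hpd : IsPipeDream a b D) (hred : IsReducedPD a b D)
    (h : ReducesToNWSEPartitions a b D) :
    IsRigid a b D := by
  intro D' hpd' hred' hperm
  have hcard : D'.card = D.card := by
    rw [← hred', ← hred, hperm]
  have key : ∀ x, x < a + b → colF D' b a x = colF D b a x := by
    intro x hx
    have h1 := col_link D' a b a le_rfl ⟨x, hx⟩
    have h2 := col_link D a b a le_rfl ⟨x, hx⟩
    change (((pdPerm a b D')⁻¹ _).val = _) at h1
    change (((pdPerm a b D)⁻¹ _).val = _) at h2
    rw [hperm] at h1
    exact h1.symm.trans h2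
  symm
  refine Finset.eq_of_subset_of_card_le ?_ hcard.le
  rintro ⟨i, j⟩ hij
  have hm := hpd hij
  simp only [Finset.mem_product, Finset.mem_Icc] at hm
  obtain ⟨⟨hi1, hia⟩, hj1, hjb⟩ := hm
  obtain ⟨i, rfl⟩ : ∃ k, i = k + 1 := ⟨i - 1, by omega⟩
  obtain ⟨j, rfl⟩ : ∃ k, j = k + 1 := ⟨j - 1, by omega⟩
  rcases h _ _ hij with h | h | h | h
  · by_contra hc
    have h1 := colF_left D b i a (by omega)
    rw [rowF_full D i b (fun c hc => h _ (by omega) (by omega)),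
      colF_fix D b i _ le_rfl] at h1
    have h2 := colF_left D' b i a (by omega)
    have h3 := rowF_elbow_le D' i j b i (by omega) hc (by omega)
    have h4 := colF_lt D' b i (rowF D' i b i) (by omega)
    have := key i (by omega)
    omega
  · by_contra hc
    have h1 := colF_up D b a j (by omega) (fun r hr => h _ (by omega) (by omega))
    have h2 := colF_elbow D' b i a j (by omega) (by omega) hc (a + j) le_rfl
    have := key (a + j) (by omega)
    omega
  · suffices H : ∀ n r c, r + c = n → r ≤ i → c ≤ j → (r + 1, c + 1) ∈ D' from
      H _ i j rfl le_rfl le_rfl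
    intro n
    induction n using Nat.strong_induction_on with
    | _ n ih =>
    intro r c hn hr hcj
    by_contra hc
    have h1 := colF_left D' b r a (by omega)
    rw [rowF_first D' r c b (by omega) hc
        (fun c' hc' => ih (r + c') (by omega) r c' rfl hr (by omega)),
      colF_up D' b r c (by omega)
        (fun r' hr' => ih (r' + c) (by omega) r' c rfl (by omega) hcj)] at h1
    have h2 := colF_left D b r a (by omega)
    have h3 := rowF_full D r (c + 1) (fun c' _ => h _ _ (by omega) (by omega) (by omega) (by omega))
    have h4 := rowF_stay_ge D r (c + 1) b r (by omega) (by omega)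
    have h5 := colF_ge D b r (rowF D r b r)
    have := key r (by omega)
    omega
  · suffices H : ∀ n r c, n + r + c = a + b → i ≤ r → j ≤ c → r < a → c < b →
        (r + 1, c + 1) ∈ D' from
      H (a + b - i - j) i j (by omega) le_rfl le_rfl (by omega) (by omega)
    intro n
    induction n using Nat.strong_induction_on with
    | _ n ih =>
    intro r c hn hr hcj hra hcb
    by_contra hc
    have h1 := colF_bot D' b (r + 1) a c hcb (by omega)
      (fun r' h1 h2 => ih (a + b - r' - c) (by omega) r' c (by omega) (by omega) hcj h2 hcb)
    simp only [colF] at h1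
    rw [show r + 1 + c = r + c + 1 by omega, rowF_last D' r c b (by omega) hc
        (fun c' h1 h2 => ih (a + b - r - c') (by omega) r c' (by omega) hr (by omega) hra h2),
      colF_fix D' b r _ le_rfl] at h1
    have h2 := colF_bot D b r a c hcb (by omega)
      (fun r' h1 h2 => h _ _ (by omega) (by omega) (by omega) (by omega))
    have h3 := colF_lt D b r (r + c) (by omega)
    have := key (a + c) (by omega)
    omega
end

section
/- Let D and D' be two reduced rectangular pipe dreams of the same shape a×b having the same permutation. Then D' can be obtained from D by a finite sequence of cross–elbow moves, i.e. there is a finite sequence D = D_0, D_1, …, D_r = D' of reduced rectangular pipe dreams of shape a×b, all with the same permutation, such that each D_{t+1} is obtained from D_t by removing one cross and adding one cross at a different position. -/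
/-- A cross–elbow move on a rectangular pipe dream of shape `a × b`: remove one cross
`p ∈ D` and add one cross at a different (elbow) position `q ∉ D`, so that the result
is again a reduced rectangular pipe dream of shape `a × b` with the same permutation. -/
def CrossElbowMove (a b : ℕ) (D D2 : Finset (ℕ × ℕ)) : Prop :=
  ∃ p q : ℕ × ℕ, p ∈ D ∧ q ∉ D ∧ D2 = insert q (D.erase p) ∧
    IsPipeDream a b D2 ∧ IsReducedPD a b D2 ∧ pdPerm a b D2 = pdPerm a b D

theorem st_lt {n j : ℕ} {x y : Fin n} (hxy : x < y) (h : ¬ (x.val = j ∧ y.val = j + 1)) :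
    simpleTransposition n j x < simpleTransposition n j y := by
  unfold simpleTransposition
  split_ifs with hj
  · simp only [Equiv.swap_apply_def, Fin.ext_iff, Fin.lt_def] at *
    split_ifs <;> simp_all <;> omega
  · simpa using hxy

theorem st_invol (n j : ℕ) : simpleTransposition n j * simpleTransposition n j = 1 := by
  unfold simpleTransposition
  split_ifs with hj <;> simp

theorem st_invol_apply (n j : ℕ) (x : Fin n) :
    simpleTransposition n j (simpleTransposition n j x) = x := by
  rw [← Equiv.Perm.mul_apply, st_invol]; rfl

theorem st_inv (n j : ℕ) : (simpleTransposition n j)⁻¹ = simpleTransposition n j :=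
  inv_eq_of_mul_eq_one_left (st_invol n j)

theorem inv_A {n : ℕ} (j : ℕ) (w : Equiv.Perm (Fin n)) :
    invCount (simpleTransposition n j * w) ≤ invCount w + 1 := by
  unfold invCount
  by_cases hj : j + 1 < n
  · refine le_trans (Finset.card_le_card (t := insert (w⁻¹ ⟨j, by omega⟩, w⁻¹ ⟨j+1, hj⟩) _) ?_)
      (Finset.card_insert_le _ _)
    rintro ⟨p, q⟩ hpq
    simp only [Finset.mem_filter, Finset.mem_univ, true_and, Finset.mem_insert] at hpq ⊢
    simp only [Equiv.Perm.mul_apply] at hpq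
    by_contra hc
    push Not at hc
    obtain ⟨h1, h2⟩ := hc
    have h3 := h2 hpq.1
    have h4 : w p < w q := lt_of_le_of_ne h3 (fun h => hpq.1.ne (w.injective h))
    refine absurd (st_lt (j := j) h4 ?_) (not_lt.2 hpq.2.le)
    rintro ⟨h5, h6⟩
    apply h1
    rw [Prod.mk.injEq, Equiv.Perm.eq_inv_iff_eq, Equiv.Perm.eq_inv_iff_eq]
    exact ⟨Fin.ext h5, Fin.ext h6⟩
  · simp [simpleTransposition, hj]

theorem inv_B {n : ℕ} (j : ℕ) (w : Equiv.Perm (Fin n))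
    (h : ¬ ∃ hj : j + 1 < n, w⁻¹ ⟨j+1, hj⟩ < w⁻¹ ⟨j, by omega⟩) :
    invCount w ≤ invCount (simpleTransposition n j * w) := by
  unfold invCount
  apply Finset.card_le_card
  rintro ⟨p, q⟩ hpq
  simp only [Finset.mem_filter, Finset.mem_univ, true_and] at hpq ⊢
  simp only [Equiv.Perm.mul_apply]
  refine ⟨hpq.1, st_lt hpq.2 ?_⟩
  rintro ⟨h5, h6⟩
  apply h
  have hj : j + 1 < n := h6 ▸ (w p).2
  refine ⟨hj, ?_⟩
  have e1 : (⟨j, by omega⟩ : Fin n) = w q := Fin.ext h5.symm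
  have e2 : (⟨j+1, hj⟩ : Fin n) = w p := Fin.ext h6.symm
  rw [e1, e2]
  simpa using hpq.1

section gen
variable {α : Type*} [DecidableEq α]

def PP (n : ℕ) (f : α → ℕ) (L : List α) (D : Finset α) : Equiv.Perm (Fin n) :=
  ((L.filter (· ∈ D)).map (fun x => simpleTransposition n (f x))).prod

theorem PP_mem {n : ℕ} {f : α → ℕ} {L : List α} {D : Finset α} {x : α} (h : x ∈ D) :
    PP n f (x :: L) D = simpleTransposition n (f x) * PP n f L D := by
  simp [PP, h]

theorem PP_not_mem {n : ℕ} {f : α → ℕ} {L : List α} {D : Finset α} {x : α} (h : x ∉ D) :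
    PP n f (x :: L) D = PP n f L D := by
  simp [PP, h]

theorem PP_congr {n : ℕ} {f : α → ℕ} {L : List α} {D E : Finset α}
    (h : ∀ x ∈ L, (x ∈ D ↔ x ∈ E)) : PP n f L D = PP n f L E := by
  unfold PP
  rw [List.filter_congr (q := (· ∈ E))]
  intro x hx
  simp [h x hx]

theorem PP_erase {n : ℕ} {f : α → ℕ} {L : List α} {D : Finset α} {x : α} (h : x ∉ L) :
    PP n f L (D.erase x) = PP n f L D := by
  apply PP_congr
  intro y hy
  have : y ≠ x := fun e => h (e ▸ hy)
  simp [this]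

theorem PP_insert {n : ℕ} {f : α → ℕ} {L : List α} {D : Finset α} {x : α} (h : x ∉ L) :
    PP n f L (insert x D) = PP n f L D := by
  apply PP_congr
  intro y hy
  have : y ≠ x := fun e => h (e ▸ hy)
  simp [this]

theorem sub_of_not_mem {L : List α} {D : Finset α} {x : α} (hD : D ⊆ (x :: L).toFinset)
    (h : x ∉ D) : D ⊆ L.toFinset := by
  intro y hy
  have := hD hy
  simp only [List.toFinset_cons, Finset.mem_insert] at this
  rcases this with rfl | h'
  · exact absurd hy h
  · exact h'

theorem sub_erase {L : List α} {D : Finset α} {x : α} (hD : D ⊆ (x :: L).toFinset) :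
    D.erase x ⊆ L.toFinset :=
  sub_of_not_mem ((Finset.erase_subset _ _).trans hD) (Finset.notMem_erase _ _)

theorem inv_PP_le {n : ℕ} {f : α → ℕ} (L : List α) : L.Nodup → ∀ D : Finset α,
    D ⊆ L.toFinset → invCount (PP n f L D) ≤ D.card := by
  induction L with
  | nil =>
    intro _ D _
    have : invCount (1 : Equiv.Perm (Fin n)) = 0 := by
      simp only [invCount, Finset.card_eq_zero, Finset.filter_eq_empty_iff]
      rintro ⟨p, q⟩ _ ⟨h1, h2⟩
      exact absurd h1 (not_lt.2 (le_of_lt h2))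
    simp [PP, this]
  | cons x L ih =>
    intro hn D hD
    obtain ⟨hx, hn⟩ := List.nodup_cons.1 hn
    by_cases h : x ∈ D
    · rw [PP_mem h, ← PP_erase hx]
      have := ih hn _ (sub_erase hD)
      rw [← Finset.card_erase_add_one h]
      exact (inv_A _ _).trans (by omega)
    · rw [PP_not_mem h]
      exact ih hn _ (sub_of_not_mem hD h)

theorem exchange {n : ℕ} {f : α → ℕ} (L : List α) : L.Nodup → ∀ (D : Finset α) (x y : Fin n),
    x < y → (PP n f L D)⁻¹ y < (PP n f L D)⁻¹ x →
    ∃ p ∈ L, p ∈ D ∧ Equiv.swap x y * PP n f L D = PP n f L (D.erase p) := by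
  induction L with
  | nil =>
    intro _ D x y h1 h2
    simp [PP] at h2
    exact absurd h1 (not_lt.2 h2.le)
  | cons z L ih =>
    intro hn D x y h1 h2
    obtain ⟨hz, hn⟩ := List.nodup_cons.1 hn
    by_cases h : z ∈ D
    · rw [PP_mem h] at h2 ⊢
      by_cases he : x.val = f z ∧ y.val = f z + 1
      · refine ⟨z, by simp, h, ?_⟩
        rw [PP_not_mem (Finset.notMem_erase _ _), PP_erase hz]
        have : Equiv.swap x y = simpleTransposition n (f z) := by
          have hj : f z + 1 < n := he.2 ▸ y.2
          rw [simpleTransposition, dif_pos hj]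
          congr 1
          · exact Fin.ext he.1
          · exact Fin.ext he.2
        rw [this, ← mul_assoc, st_invol, one_mul]
      · have h3 := st_lt h1 he
        rw [mul_inv_rev, st_inv, Equiv.Perm.mul_apply, Equiv.Perm.mul_apply] at h2
        obtain ⟨p, hp, hpD, e⟩ := ih hn D _ _ h3 h2
        refine ⟨p, by simp [hp], hpD, ?_⟩
        have hzp : z ≠ p := fun e => hz (e ▸ hp)
        rw [PP_mem (Finset.mem_erase.2 ⟨hzp, h⟩), ← e, ← mul_assoc, ← mul_assoc]
        congr 1
        rw [Equiv.mul_swap_eq_swap_mul, st_invol_apply, st_invol_apply]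
    · rw [PP_not_mem h] at h2 ⊢
      obtain ⟨p, hp, hpD, e⟩ := ih hn D x y h1 h2
      refine ⟨p, by simp [hp], hpD, ?_⟩
      rw [PP_not_mem (fun h' => h (Finset.mem_of_mem_erase h')), e]

def Mv (n : ℕ) (f : α → ℕ) (L : List α) (D E : Finset α) : Prop :=
  D ⊆ L.toFinset ∧ E ⊆ L.toFinset ∧ PP n f L E = PP n f L D ∧
    ∃ p q, p ∈ D ∧ q ∉ D ∧ E = insert q (D.erase p)

theorem Mv_symm {n : ℕ} {f : α → ℕ} {L : List α} {D E : Finset α} (h : Mv n f L D E) :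
    Mv n f L E D := by
  obtain ⟨h1, h2, h3, p, q, hp, hq, rfl⟩ := h
  refine ⟨h2, h1, h3.symm, q, p, by simp, ?_, ?_⟩
  · have : p ≠ q := fun e => hq (e ▸ hp)
    simp [this]
  · rw [Finset.erase_insert (fun h' => hq (Finset.mem_of_mem_erase h')), Finset.insert_erase hp]

theorem lift_not {n : ℕ} {f : α → ℕ} {L : List α} {x : α} (hx : x ∉ L) {D E : Finset α}
    (h : Mv n f L D E) : Mv n f (x :: L) D E := by
  obtain ⟨h1, h2, h3, h4⟩ := h
  have hs : L.toFinset ⊆ (x :: L).toFinset := by simp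
  refine ⟨h1.trans hs, h2.trans hs, ?_, h4⟩
  rw [PP_not_mem (fun h => hx (by simpa using h2 h)), PP_not_mem (fun h => hx (by simpa using h1 h)), h3]

theorem lift_mem {n : ℕ} {f : α → ℕ} {L : List α} {x : α} (hx : x ∉ L) {D E : Finset α}
    (h : Mv n f L D E) : Mv n f (x :: L) (insert x D) (insert x E) := by
  obtain ⟨h1, h2, h3, p, q, hp, hq, he⟩ := h
  have hxD : x ∉ D := fun h => hx (by simpa using h1 h)
  have hxE : x ∉ E := fun h => hx (by simpa using h2 h)
  have hqx : q ≠ x := fun e => hxE (by rw [he, ← e]; simp)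
  have hpx : p ≠ x := fun e => hxD (e ▸ hp)
  refine ⟨?_, ?_, ?_, p, q, by simp [hp], by simp [hq, hqx], ?_⟩
  · rw [List.toFinset_cons]; exact Finset.insert_subset_insert _ h1
  · rw [List.toFinset_cons]; exact Finset.insert_subset_insert _ h2
  · rw [PP_mem (by simp), PP_mem (by simp), PP_insert hx, PP_insert hx, h3]
  · rw [he, Finset.erase_insert_of_ne hpx.symm, Finset.insert_comm]

/-- The link between facets with and without the first letter. -/
theorem link {n : ℕ} {f : α → ℕ} {L : List α} {x : α} (hx : x ∉ L) (hn : L.Nodup)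
    {D E : Finset α} (hD : D ⊆ (x :: L).toFinset) (hE : E ⊆ (x :: L).toFinset)
    (hxD : x ∈ D) (hxE : x ∉ E)
    (hr : invCount (PP n f (x :: L) D) = D.card)
    (hp : PP n f (x :: L) E = PP n f (x :: L) D) :
    ∃ p ∈ E, Mv n f (x :: L) E (insert x (E.erase p)) := by
  have hdes : ∃ hj : f x + 1 < n, (PP n f (x :: L) D)⁻¹ ⟨f x + 1, hj⟩ <
      (PP n f (x :: L) D)⁻¹ ⟨f x, by omega⟩ := by
    by_contra hc
    have h1 := inv_B _ _ hc
    rw [hr] at h1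
    have h2 := inv_PP_le (n := n) (f := f) L hn _ (sub_erase hD)
    rw [PP_mem hxD, ← mul_assoc, st_invol, one_mul, ← PP_erase hx] at h1
    have := Finset.card_erase_add_one hxD
    omega
  obtain ⟨hj, hd⟩ := hdes
  rw [← hp, PP_not_mem hxE] at hd
  obtain ⟨p, hpL, hpE, e⟩ := exchange L hn E _ _ (by simp [Fin.lt_def]) hd
  have hst : Equiv.swap (⟨f x, by omega⟩ : Fin n) ⟨f x + 1, hj⟩ = simpleTransposition n (f x) := by
    rw [simpleTransposition, dif_pos hj]
  rw [hst] at e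
  refine ⟨p, hpE, hE, ?_, ?_, p, x, hpE, hxE, rfl⟩
  · apply Finset.insert_subset (by simp) ((Finset.erase_subset _ _).trans hE)
  · rw [PP_mem (by simp), PP_insert hx, ← e, ← mul_assoc, st_invol, one_mul, PP_not_mem hxE]

theorem conn {n : ℕ} {f : α → ℕ} (L : List α) : L.Nodup → ∀ D E : Finset α,
    D ⊆ L.toFinset → E ⊆ L.toFinset → invCount (PP n f L D) = D.card →
    invCount (PP n f L E) = E.card → PP n f L E = PP n f L D →
    Relation.ReflTransGen (Mv n f L) D E := by
  induction L with
  | nil =>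
    intro _ D E hD hE _ _ _
    simp at hD hE
    subst hD hE
    exact .refl
  | cons x L ih =>
    intro hn D E hD hE hrD hrE hp
    obtain ⟨hx, hn⟩ := List.nodup_cons.1 hn
    have red : ∀ D : Finset α, D ⊆ (x :: L).toFinset → x ∈ D →
        invCount (PP n f (x :: L) D) = D.card →
        invCount (PP n f L (D.erase x)) = (D.erase x).card := by
      intro D hD hxD hr
      have h1 := inv_PP_le (n := n) (f := f) L hn _ (sub_erase hD)
      rw [PP_mem hxD, ← PP_erase hx] at hr
      have h2 := inv_A (f x) (PP n f L (D.erase x))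
      have := Finset.card_erase_add_one hxD
      omega
    have both : ∀ D E : Finset α, D ⊆ (x :: L).toFinset → E ⊆ (x :: L).toFinset →
        invCount (PP n f (x :: L) D) = D.card → invCount (PP n f (x :: L) E) = E.card →
        PP n f (x :: L) E = PP n f (x :: L) D → x ∈ D → x ∈ E →
        Relation.ReflTransGen (Mv n f (x :: L)) D E := by
      intro D E hD hE hrD hrE hp hxD hxE
      have h := ih hn (D.erase x) (E.erase x) (sub_erase hD) (sub_erase hE) (red D hD hxD hrD)
        (red E hE hxE hrE) (by
          rw [PP_mem hxD, PP_mem hxE] at hp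
          rw [PP_erase hx, PP_erase hx]
          exact mul_left_cancel hp)
      have := Relation.ReflTransGen.lift (p := Mv n f (x :: L)) (insert x)
        (fun _ _ h => lift_mem hx h) _ _ h
      simpa [Function.onFun, Finset.insert_erase hxD, Finset.insert_erase hxE] using this
    have mixed : ∀ D E : Finset α, D ⊆ (x :: L).toFinset → E ⊆ (x :: L).toFinset →
        invCount (PP n f (x :: L) D) = D.card → invCount (PP n f (x :: L) E) = E.card →
        PP n f (x :: L) E = PP n f (x :: L) D → x ∈ D → x ∉ E →
        Relation.ReflTransGen (Mv n f (x :: L)) D E := by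
      intro D E hD hE hrD hrE hp hxD hxE
      obtain ⟨p, hpE, hm⟩ := link hx hn hD hE hxD hxE hrD hp
      refine (both D _ hD hm.2.1 hrD ?_ (hm.2.2.1.trans hp) hxD (by simp)).tail (Mv_symm hm)
      rw [hm.2.2.1, hrE, Finset.card_insert_of_notMem (fun h => hxE (Finset.mem_of_mem_erase h)),
        Finset.card_erase_add_one hpE]
    by_cases hxD : x ∈ D <;> by_cases hxE : x ∈ E
    · exact both D E hD hE hrD hrE hp hxD hxE
    · exact mixed D E hD hE hrD hrE hp hxD hxE
    · have := mixed E D hE hD hrE hrD hp.symm hxE hxD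
      rw [← Relation.reflTransGen_swap] at this
      exact Relation.ReflTransGen.mono (fun _ _ h => Mv_symm h) _ _ this
    · rw [PP_not_mem hxD] at hrD hp
      rw [PP_not_mem hxE] at hrE hp
      exact Relation.ReflTransGen.mono (fun _ _ h => lift_not hx h) _ _
        (ih hn D E (sub_of_not_mem hD hxD) (sub_of_not_mem hE hxE) hrD hrE hp)

end gen

def gridL (a b : ℕ) : List (ℕ × ℕ) :=
  (List.range a).reverse.flatMap fun r => (List.range b).map fun c => (r + 1, c + 1)

theorem gridL_nodup (a b : ℕ) : (gridL a b).Nodup := by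
  unfold gridL
  rw [List.nodup_flatMap]
  constructor
  · intro r _
    exact List.nodup_range.map (fun c d h => by simpa using h)
  · refine List.Pairwise.imp ?_ (List.nodup_reverse.2 List.nodup_range)
    intro r s hrs
    simp only [Function.onFun, List.disjoint_left, List.mem_map]
    rintro _ ⟨c, _, rfl⟩ ⟨d, _, h⟩
    simp at h
    exact hrs h.1.symm

theorem gridL_toFinset (a b : ℕ) :
    (gridL a b).toFinset = Finset.Icc 1 a ×ˢ Finset.Icc 1 b := by
  ext ⟨i, j⟩
  simp only [gridL, List.mem_toFinset, List.mem_flatMap, List.mem_reverse, List.mem_range,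
    List.mem_map, Prod.mk.injEq, Finset.mem_product, Finset.mem_Icc]
  constructor
  · rintro ⟨r, hr, c, hc, rfl, rfl⟩
    omega
  · rintro ⟨⟨h1, h2⟩, h3, h4⟩
    exact ⟨i - 1, by omega, j - 1, by omega, by omega, by omega⟩

theorem pdPerm_eq (a b : ℕ) (D : Finset (ℕ × ℕ)) :
    pdPerm a b D = PP (a + b) (fun p => (p.1 - 1) + (p.2 - 1)) (gridL a b) D := by
  have : readingWord a b D = ((gridL a b).filter (· ∈ D)).map (fun p => (p.1 - 1) + (p.2 - 1)) := by
    unfold readingWord gridL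
    rw [List.filter_flatMap, List.map_flatMap]
    congr 1
    funext r
    induction (List.range b) with
    | nil => rfl
    | cons c l ih =>
      by_cases h : (r + 1, c + 1) ∈ D <;> simp [h] at ih ⊢ <;> exact ih
  rw [pdPerm, this, PP, List.map_map]
  rfl

/-- Any two reduced rectangular pipe dreams of the same shape `a × b`
with the same permutation are connected by a finite sequence of cross–elbow moves. -/
theorem connected_by_cross_elbow_moves (a b : ℕ) (D D' : Finset (ℕ × ℕ))
    (hpd : IsPipeDream a b D) (hred : IsReducedPD a b D)
    (hpd' : IsPipeDream a b D') (hred' : IsReducedPD a b D')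
    (hperm : pdPerm a b D' = pdPerm a b D) :
    Relation.ReflTransGen (CrossElbowMove a b) D D' := by
  simp only [IsPipeDream, ← gridL_toFinset] at hpd hpd'
  have hr := hred
  simp only [IsReducedPD, pdPerm_eq] at hred hred' hperm
  have h := conn _ (gridL_nodup a b) D D' hpd hpd' hred hred' hperm
  clear hpd' hred' hperm hpd hred
  suffices H : Relation.ReflTransGen (CrossElbowMove a b) D D' ∧ IsReducedPD a b D' from H.1
  induction h with
  | refl => exact ⟨.refl, hr⟩
  | @tail B C _ hm ih =>
    obtain ⟨h1, h2, h3, p, q, hp, hq, he⟩ := hm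
    rw [← pdPerm_eq, ← pdPerm_eq] at h3
    have hred2 := ih.2
    have hr3 : IsReducedPD a b C := by
      rw [IsReducedPD, ← h3] at hred2
      rw [IsReducedPD, hred2, he,
        Finset.card_insert_of_notMem (fun h => hq (Finset.mem_of_mem_erase h)),
        Finset.card_erase_add_one hp]
    exact ⟨ih.1.tail ⟨p, q, hp, hq, he, by rw [IsPipeDream, ← gridL_toFinset]; exact h2,
      hr3, h3⟩, hr3⟩
end
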